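/- arXiv:2005.02615 — 3 statements merged into one kernel-verified Lean document; each statement's English description precedes it below -/
import Mathlib

section
/- Let p, f₀, v₀, α, β be integers satisfying p² + 6p·f₀ + f₀² = 28v₀² and α·(f₀ + 3p) − 14β·v₀ = 2. Then 49·(β·(f₀ + 3p) − 2α·v₀)² = 28 + 56p²·(7β² − α²). -/
/-- The "K = −7" identity arising when completing the square in the descent. -/
theorem stmt12 (p f₀ v₀ α β : ℤ)
    (h1 : p ^ 2 + 6 * p * f₀ + f₀ ^ 2 = 28 * v₀ ^ 2)
    (h2 : α * (f₀ + 3 * p) - 14 * β * v₀ = 2) :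
    49 * (β * (f₀ + 3 * p) - 2 * α * v₀) ^ 2 = 28 + 56 * p ^ 2 * (7 * β ^ 2 - α ^ 2) := by
  linear_combination 7 * (α * (f₀ + 3 * p) - 14 * β * v₀ + 2) * h2 + 7 * (7 * β ^ 2 - α ^ 2) * h1
end

section
/- Let p, f₀, v₀, α, β be integers satisfying p² + 6p·f₀ + f₀² = 28v₀² and α·(f₀ + 3p) − 14β·v₀ = 2. For integers x, y, define D = β·(f₀+3p) − 2α·v₀, s = 4xy, t = x² + 28y² − 14D·xy, m = 14p²·s², n = s·t, g = t² + 7D·t·s + 14p²·(7β² − α²)·s², and f = f₀·g + 4·(α·m + 7v₀·n). Then f = f₀·x⁴ + 112v₀·x³y + 56·(8α·(2p² + 7v₀²) − 28β·v₀·(f₀+3p) − f₀)·x²y² + 3136v₀·x·y³ + 784f₀·y⁴. -/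
/-- The final quartic form for f = d² in the descent for N = 7p. -/
theorem stmt13 (p f₀ v₀ α β : ℤ)
    (h1 : p ^ 2 + 6 * p * f₀ + f₀ ^ 2 = 28 * v₀ ^ 2)
    (h2 : α * (f₀ + 3 * p) - 14 * β * v₀ = 2)
    (x y : ℤ) :
    let D := β * (f₀ + 3 * p) - 2 * α * v₀
    let s := 4 * x * y
    let t := x ^ 2 + 28 * y ^ 2 - 14 * D * x * y
    let m := 14 * p ^ 2 * s ^ 2
    let n := s * t
    let g := t ^ 2 + 7 * D * t * s + 14 * p ^ 2 * (7 * β ^ 2 - α ^ 2) * s ^ 2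
    let f := f₀ * g + 4 * (α * m + 7 * v₀ * n)
    f = f₀ * x ^ 4 + 112 * v₀ * x ^ 3 * y +
        56 * (8 * α * (2 * p ^ 2 + 7 * v₀ ^ 2) - 28 * β * v₀ * (f₀ + 3 * p) - f₀) *
          x ^ 2 * y ^ 2 +
        3136 * v₀ * x * y ^ 3 + 784 * f₀ * y ^ 4 := by
  intro D s t m n g f
  have key : 4 - 7 * D ^ 2 = 8 * p ^ 2 * (α ^ 2 - 7 * β ^ 2) := by
    simp only [D]
    linear_combination
      (-(α * (f₀ + 3 * p) - 14 * β * v₀) - 2) * h2 + (α ^ 2 - 7 * β ^ 2) * h1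
  simp only [f, g, n, m, t, s]
  simp only [D] at key ⊢
  linear_combination 28 * f₀ * x ^ 2 * y ^ 2 * key
end

section
/- Let p, f₀, v₀, α, β be integers satisfying p² + 6p·f₀ + f₀² = 28v₀² and α·(f₀ + 3p) − 14β·v₀ = 2, and suppose f₀ + 3p is even with A = (f₀ + 3p)/2. Then for all integers g, m, n, setting j = 2·(α·m + 7v₀·n) and i = 2·(β·m + A·n), one has (f₀ + 3p)·g·j − 14v₀·g·i + j² − 7i² = 4·( m·(g + (α² − 7β²)·m + 7·(2α·v₀ − β·(f₀ + 3p))·n) − 14p²·n² ). -/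
/-- The Bézout change of variables reduces the translated equation to
m·r = 14p²n². -/
theorem stmt15 (p f₀ v₀ α β : ℤ)
    (h1 : p ^ 2 + 6 * p * f₀ + f₀ ^ 2 = 28 * v₀ ^ 2)
    (h2 : α * (f₀ + 3 * p) - 14 * β * v₀ = 2)
    (heven : Even (f₀ + 3 * p)) (A : ℤ) (hA : A = (f₀ + 3 * p) / 2) :
    ∀ g m n : ℤ,
      let j := 2 * (α * m + 7 * v₀ * n)
      let i := 2 * (β * m + A * n)
      (f₀ + 3 * p) * g * j - 14 * v₀ * g * i + j ^ 2 - 7 * i ^ 2 =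
        4 * (m * (g + (α ^ 2 - 7 * β ^ 2) * m +
              7 * (2 * α * v₀ - β * (f₀ + 3 * p)) * n) - 14 * p ^ 2 * n ^ 2) := by
  intro g m n j i
  have hf : f₀ = 2 * A - 3 * p := by
    obtain ⟨k, hk⟩ := heven
    omega
  subst hf
  linear_combination 2 * g * m * h2 - 7 * n ^ 2 * h1
end
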